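/- ∑_{n≥1} 1 / (n² · 12^n · binom(3n, n)) = (2/3)·arctan(√15/9)² − (1/2)·log(3/2)². -/

import Mathlib

open MeasureTheory Set

/-- The Beta integral at natural number arguments. -/
theorem integral_pow_mul_one_sub_pow (a b : ℕ) :
    ∫ x in (0 : ℝ)..1, x ^ a * (1 - x) ^ b =
      (a.factorial * b.factorial : ℝ) / (a + b + 1).factorial := by
  induction b generalizing a with
  | zero =>
    simp only [pow_zero, mul_one, integral_pow, add_zero, Nat.factorial_succ, Nat.factorial_zero]
    have := Nat.factorial_pos a
    push_cast
    field_simp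
    simp
  | succ b ih =>
    have hderiv : ∀ x ∈ uIcc (0 : ℝ) 1, HasDerivAt (fun x : ℝ => x ^ (a + 1) * (1 - x) ^ (b + 1))
        ((a + 1) * (x ^ a * (1 - x) ^ (b + 1)) - (b + 1) * (x ^ (a + 1) * (1 - x) ^ b)) x := by
      intro x _
      have h := (hasDerivAt_pow (a + 1) x).mul (((hasDerivAt_id x).const_sub 1).pow (b + 1))
      convert! h using 1
      simp
      ring
    have hint := intervalIntegral.integral_eq_sub_of_hasDerivAt hderiv
      (Continuous.intervalIntegrable (by fun_prop) 0 1)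
    rw [intervalIntegral.integral_sub (Continuous.intervalIntegrable (by fun_prop) 0 1)
      (Continuous.intervalIntegrable (by fun_prop) 0 1), intervalIntegral.integral_const_mul,
      intervalIntegral.integral_const_mul, ih] at hint
    have hsum : a + 1 + b + 1 = a + (b + 1) + 1 := by ring
    rw [hsum] at hint
    have h1 : ((a + (b + 1) + 1).factorial : ℝ) ≠ 0 := by positivity
    have h2 : (a + 1 : ℝ) ≠ 0 := by positivity
    apply mul_left_cancel₀ h2
    rw [eq_of_sub_eq_zero (hint.trans (by simp))]
    simp only [Nat.factorial_succ a, Nat.factorial_succ b]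
    push_cast
    ring

theorem integral_pow_mul_one_sub_pow_eq_choose (n : ℕ) :
    ∫ x in (0 : ℝ)..1, x ^ n * (1 - x) ^ (2 * (n + 1)) =
      1 / ((n + 1) * (Nat.choose (3 * (n + 1)) (n + 1))) := by
  rw [integral_pow_mul_one_sub_pow, Nat.cast_choose ℝ (by omega : n + 1 ≤ 3 * (n + 1)),
    show 3 * (n + 1) - (n + 1) = 2 * (n + 1) by omega,
    show n + 2 * (n + 1) + 1 = 3 * (n + 1) by ring, Nat.factorial_succ n]
  have h1 : ((3 * (n + 1)).factorial : ℝ) ≠ 0 := by positivity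
  have h2 : ((2 * (n + 1)).factorial : ℝ) ≠ 0 := by positivity
  have h3 : (n.factorial : ℝ) ≠ 0 := by positivity
  push_cast
  field_simp

theorem mul_one_sub_sq_mem_Icc {x : ℝ} (hx : x ∈ Icc (0 : ℝ) 1) :
    x * (1 - x) ^ 2 ∈ Icc (0 : ℝ) 1 := by
  obtain ⟨h0, h1⟩ := hx
  have h2 : 0 ≤ 1 - x := by linarith
  exact ⟨by positivity, mul_le_one₀ h1 (by positivity) (pow_le_one₀ h2 (by linarith))⟩

theorem hasSum_pow_div_mul_choose {t : ℝ} (ht : |t| < 1 / 2) :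
    HasSum (fun n : ℕ => t ^ n / ((n + 1) * (Nat.choose (3 * (n + 1)) (n + 1))))
      (∫ x in (0 : ℝ)..1, (1 - x) ^ 2 / (1 - t * (x * (1 - x) ^ 2))) := by
  have hbound : ∀ x ∈ Icc (0 : ℝ) 1, |t * (x * (1 - x) ^ 2)| ≤ 1 / 2 := by
    intro x hx
    obtain ⟨h0, h1⟩ := mul_one_sub_sq_mem_Icc hx
    rw [abs_mul, abs_of_nonneg h0]
    nlinarith [abs_nonneg t]
  have hmem : ∀ x ∈ uIoc (0 : ℝ) 1, x ∈ Icc (0 : ℝ) 1 := by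
    intro x hx
    rw [uIoc_of_le zero_le_one] at hx
    exact Ioc_subset_Icc_self hx
  have key : HasSum
      (fun n : ℕ => ∫ x in (0 : ℝ)..1, (1 - x) ^ 2 * (t * (x * (1 - x) ^ 2)) ^ n)
      (∫ x in (0 : ℝ)..1, (1 - x) ^ 2 / (1 - t * (x * (1 - x) ^ 2))) := by
    refine intervalIntegral.hasSum_integral_of_dominated_convergence
      (fun n _ => (1 / 2 : ℝ) ^ n) (fun n => ?_) (fun n => ?_) ?_ ?_ ?_
    · exact Continuous.aestronglyMeasurable (by fun_prop)
    · refine .of_forall fun x hx => ?_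
      obtain ⟨h0, h1⟩ := hmem x hx
      rw [norm_mul, norm_pow, norm_pow, Real.norm_eq_abs, Real.norm_eq_abs]
      have h2 : |1 - x| ^ 2 ≤ 1 :=
        pow_le_one₀ (abs_nonneg _) (abs_le.2 ⟨by linarith, by linarith⟩)
      have h3 := pow_le_pow_left₀ (abs_nonneg _) (hbound x ⟨h0, h1⟩) n
      calc _ ≤ 1 * (1 / 2 : ℝ) ^ n := by gcongr
        _ = _ := one_mul _
    · exact .of_forall fun x hx => summable_geometric_two
    · exact intervalIntegrable_const
    · refine .of_forall fun x hx => ?_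
      rw [div_eq_mul_inv]
      refine (hasSum_geometric_of_abs_lt_one ?_).mul_left _
      exact (hbound x (hmem x hx)).trans_lt (by norm_num)
  convert key using 2 with n
  rw [div_eq_mul_one_div, ← integral_pow_mul_one_sub_pow_eq_choose,
    ← intervalIntegral.integral_const_mul]
  congr 1 with x
  simp only [mul_pow, ← pow_mul]
  ring

theorem hasDerivAt_tsum_pow_div_sq_mul_choose {t : ℝ} (ht : |t| < 1 / 2) :
    HasDerivAt
      (fun t : ℝ => ∑' n : ℕ, t ^ (n + 1) / ((n + 1) ^ 2 * (Nat.choose (3 * (n + 1)) (n + 1))))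
      (∫ x in (0 : ℝ)..1, (1 - x) ^ 2 / (1 - t * (x * (1 - x) ^ 2))) t := by
  rw [← (hasSum_pow_div_mul_choose ht).tsum_eq]
  have hmem : ∀ y : ℝ, y ∈ Ioo (-(1 / 2) : ℝ) (1 / 2) ↔ |y| < 1 / 2 := fun y => abs_lt.symm
  refine hasDerivAt_tsum_of_isPreconnected
    (g := fun (n : ℕ) (t : ℝ) =>
      t ^ (n + 1) / ((n + 1) ^ 2 * (Nat.choose (3 * (n + 1)) (n + 1))))
    (g' := fun (n : ℕ) (t : ℝ) => t ^ n / ((n + 1) * (Nat.choose (3 * (n + 1)) (n + 1))))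
    (u := fun n : ℕ => (1 / 2 : ℝ) ^ n) (t := Ioo (-(1 / 2)) (1 / 2)) (y₀ := 0)
    summable_geometric_two isOpen_Ioo isPreconnected_Ioo
    (fun n y _ => ?_) (fun n y hy => ?_) (by norm_num) ?_ ((hmem t).2 ht)
  · convert! (hasDerivAt_pow (n + 1) y).div_const
      ((n + 1 : ℝ) ^ 2 * (Nat.choose (3 * (n + 1)) (n + 1))) using 1
    push_cast
    have : (0 : ℝ) < (Nat.choose (3 * (n + 1)) (n + 1)) := by
      exact_mod_cast Nat.choose_pos (by omega)
    field_simp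
  · rw [norm_div, norm_pow, Real.norm_eq_abs y]
    have hc : 1 ≤ Nat.choose (3 * (n + 1)) (n + 1) := Nat.choose_pos (by omega)
    have h1 : (1 : ℝ) ≤ (n + 1) * (Nat.choose (3 * (n + 1)) (n + 1)) := by
      exact_mod_cast Nat.mul_pos n.succ_pos hc
    refine (div_le_self (by positivity) (h1.trans (Real.le_norm_self _))).trans ?_
    exact pow_le_pow_left₀ (abs_nonneg _) ((hmem y).1 hy).le n
  · simp

theorem hasDerivAt_arctan_mul_sqrt_div {s : ℝ} (h1 : s ≤ 1 / 3) :
    HasDerivAt (fun s : ℝ => Real.arctan (s * √(3 - 4 * s) / (2 - 3 * s)))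
      (3 / (2 * (1 - s) * √(3 - 4 * s))) s := by
  have hpos : 0 < 3 - 4 * s := by linarith
  have hden : 0 < 2 - 3 * s := by linarith
  have hs : 0 < 1 - s := by linarith
  have hw : HasDerivAt (fun s : ℝ => √(3 - 4 * s)) (-4 / (2 * √(3 - 4 * s))) s := by
    have := (((hasDerivAt_id s).const_mul 4).const_sub 3).sqrt hpos.ne'
    simpa using this
  have hd : HasDerivAt (fun s : ℝ => 2 - 3 * s) (-3) s := by
    simpa using ((hasDerivAt_id s).const_mul 3).const_sub 2
  have h := (((hasDerivAt_id s).mul hw).div hd hden.ne').arctan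
  convert! h using 1
  have hsq := Real.sq_sqrt hpos.le
  have hw0 : 0 < √(3 - 4 * s) := Real.sqrt_pos.2 hpos
  simp only [Pi.div_apply, Pi.mul_apply, id]
  set w := √(3 - 4 * s)
  have hD : 1 + (s * w / (2 - 3 * s)) ^ 2 = 4 * (1 - s) ^ 3 / (2 - 3 * s) ^ 2 := by
    rw [div_pow, one_add_div (pow_ne_zero 2 hden.ne')]
    congr 1
    linear_combination s ^ 2 * hsq
  rw [hD]
  field_simp
  linear_combination (-4) * hsq

theorem integral_one_sub_sq_div {s : ℝ} (h0 : 0 < s) (h1 : s < 1 / 3) :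
    (∫ x in (0 : ℝ)..1, (1 - x) ^ 2 / (1 - s ^ 3 / (1 - s) ^ 2 * (x * (1 - x) ^ 2))) *
        (s ^ 2 * (3 - s) / (1 - s) ^ 3) =
      Real.log (1 - s) / (1 - s) +
        2 / ((1 - s) * √(3 - 4 * s)) * Real.arctan (s * √(3 - 4 * s) / (2 - 3 * s)) := by
  have hpos : 0 < 3 - 4 * s := by linarith
  have hs : 0 < 1 - s := by linarith
  have hsq := Real.sq_sqrt hpos.le
  have hw0 : 0 < √(3 - 4 * s) := Real.sqrt_pos.2 hpos
  set w := √(3 - 4 * s)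
  have hlin : ∀ x ∈ Icc (0 : ℝ) 1, 0 < 1 - s * x := by
    rintro x ⟨hx0, hx1⟩
    nlinarith
  have hquad : ∀ x ∈ Icc (0 : ℝ) 1, 0 < (1 - s) ^ 2 + s * (1 - 2 * s) * x + s ^ 2 * x ^ 2 := by
    rintro x ⟨hx0, hx1⟩
    have : 0 < 1 - 2 * s := by linarith
    positivity
  have hatan : ∀ x ∈ Icc (0 : ℝ) 1, 0 < 2 * (1 - s) ^ 2 + s * (1 - 2 * s) * x := by
    rintro x ⟨hx0, hx1⟩
    have : 0 < 1 - 2 * s := by linarith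
    positivity
  have hfactor : ∀ x : ℝ, 1 - s ^ 3 / (1 - s) ^ 2 * (x * (1 - x) ^ 2) =
      (1 - s * x) * ((1 - s) ^ 2 + s * (1 - 2 * s) * x + s ^ 2 * x ^ 2) / (1 - s) ^ 2 := by
    intro x
    field_simp
    ring
  have hderiv : ∀ x ∈ uIcc (0 : ℝ) 1, HasDerivAt
      (fun x : ℝ => -(1 / s) * Real.log (1 - s * x) -
        1 / (s * (1 - s)) * Real.log ((1 - s) ^ 2 + s * (1 - 2 * s) * x + s ^ 2 * x ^ 2) +
        2 / ((1 - s) * w) * Real.arctan (s * w * x / (2 * (1 - s) ^ 2 + s * (1 - 2 * s) * x)))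
      ((1 - x) ^ 2 / (1 - s ^ 3 / (1 - s) ^ 2 * (x * (1 - x) ^ 2)) *
        (s ^ 2 * (3 - s) / (1 - s) ^ 3)) x := by
    intro x hx
    rw [uIcc_of_le zero_le_one] at hx
    have hL := hlin x hx
    have hQ := hquad x hx
    have hA := hatan x hx
    have d1 : HasDerivAt (fun x : ℝ => 1 - s * x) (-s) x := by
      simpa using ((hasDerivAt_id x).const_mul s).const_sub 1
    have d2 : HasDerivAt (fun x : ℝ => (1 - s) ^ 2 + s * (1 - 2 * s) * x + s ^ 2 * x ^ 2)
        (s * (1 - 2 * s) + s ^ 2 * (2 * x)) x := by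
      convert! (((hasDerivAt_id x).const_mul (s * (1 - 2 * s))).const_add ((1 - s) ^ 2)).add
        ((hasDerivAt_pow 2 x).const_mul (s ^ 2)) using 1
      simp
    have d3 : HasDerivAt (fun x : ℝ => s * w * x) (s * w) x := by
      simpa using (hasDerivAt_id x).const_mul (s * w)
    have d4 : HasDerivAt (fun x : ℝ => 2 * (1 - s) ^ 2 + s * (1 - 2 * s) * x)
        (s * (1 - 2 * s)) x := by
      simpa using ((hasDerivAt_id x).const_mul (s * (1 - 2 * s))).const_add (2 * (1 - s) ^ 2)
    have h := (((d1.log hL.ne').const_mul (-(1 / s))).sub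
      ((d2.log hQ.ne').const_mul (1 / (s * (1 - s))))).add
      ((d3.div d4 hA.ne').arctan.const_mul (2 / ((1 - s) * w)))
    convert! h using 1
    have hD : 1 + (s * w * x / (2 * (1 - s) ^ 2 + s * (1 - 2 * s) * x)) ^ 2 =
        4 * (1 - s) ^ 2 * ((1 - s) ^ 2 + s * (1 - 2 * s) * x + s ^ 2 * x ^ 2) /
          (2 * (1 - s) ^ 2 + s * (1 - 2 * s) * x) ^ 2 := by
      rw [div_pow, one_add_div (pow_ne_zero 2 hA.ne')]
      congr 1
      linear_combination s ^ 2 * x ^ 2 * hsq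
    simp only [Pi.div_apply]
    rw [hD, hfactor]
    generalize hQd : (1 - s) ^ 2 + s * (1 - 2 * s) * x + s ^ 2 * x ^ 2 = Q at *
    generalize hAd : 2 * (1 - s) ^ 2 + s * (1 - 2 * s) * x = A at *
    generalize hLd : 1 - s * x = L at *
    have e3 : 2 / ((1 - s) * w) *
        (1 / (4 * (1 - s) ^ 2 * Q / A ^ 2) * ((s * w * A - s * w * x * (s * (1 - 2 * s))) / A ^ 2)) =
        s / ((1 - s) * Q) := by
      have : A - x * (s * (1 - 2 * s)) = 2 * (1 - s) ^ 2 := by rw [← hAd]; ring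
      rw [show s * w * A - s * w * x * (s * (1 - 2 * s)) =
        s * w * (A - x * (s * (1 - 2 * s))) by ring, this]
      field_simp
      ring
    rw [e3]
    field_simp
    subst hQd hLd
    ring
  have hint : IntervalIntegrable (fun x : ℝ =>
      (1 - x) ^ 2 / (1 - s ^ 3 / (1 - s) ^ 2 * (x * (1 - x) ^ 2)) *
        (s ^ 2 * (3 - s) / (1 - s) ^ 3)) volume 0 1 := by
    refine ContinuousOn.intervalIntegrable (ContinuousOn.mul (ContinuousOn.div (by fun_prop)
      (by fun_prop) fun x hx => ?_) continuousOn_const)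
    rw [uIcc_of_le zero_le_one] at hx
    have := hlin x hx
    have := hquad x hx
    rw [hfactor]
    positivity
  rw [← intervalIntegral.integral_mul_const,
    intervalIntegral.integral_eq_sub_of_hasDerivAt hderiv hint]
  have e1 : (1 - s) ^ 2 + s * (1 - 2 * s) * 1 + s ^ 2 * 1 ^ 2 = 1 - s := by ring
  have e2 : s * w * 1 / (2 * (1 - s) ^ 2 + s * (1 - 2 * s) * 1) = s * w / (2 - 3 * s) := by
    congr 1 <;> ring
  rw [e1, e2]
  simp only [mul_zero, mul_one, sub_zero, add_zero, zero_div, Real.arctan_zero, Real.log_one,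
    ne_eq, OfNat.ofNat_ne_zero, not_false_eq_true, zero_pow, Real.log_pow]
  push_cast
  field_simp
  ring

/-- The series `∑ tⁿ / (n² (3n choose n))`, uniformised by `t = s³ / (1 - s)²`. -/
theorem tsum_pow_div_sq_mul_choose_eq {s : ℝ} (hs : s ∈ Icc (0 : ℝ) (1 / 3)) :
    ∑' n : ℕ, (s ^ 3 / (1 - s) ^ 2) ^ (n + 1) /
        ((n + 1) ^ 2 * (Nat.choose (3 * (n + 1)) (n + 1)) : ℝ) =
      2 / 3 * Real.arctan (s * √(3 - 4 * s) / (2 - 3 * s)) ^ 2 -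
        1 / 2 * Real.log (1 - s) ^ 2 := by
  have ht : ∀ s ∈ Icc (0 : ℝ) (1 / 3), |s ^ 3 / (1 - s) ^ 2| < 1 / 2 := by
    rintro s ⟨h0, h1⟩
    have hs : 0 < 1 - s := by linarith
    rw [abs_of_nonneg (by positivity), div_lt_iff₀ (by positivity)]
    have : s ^ 3 ≤ (1 / 3) ^ 3 := by gcongr
    nlinarith
  have hderiv : ∀ s ∈ Icc (0 : ℝ) (1 / 3), HasDerivAt (fun s : ℝ =>
      (∑' n : ℕ, (s ^ 3 / (1 - s) ^ 2) ^ (n + 1) /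
        ((n + 1) ^ 2 * (Nat.choose (3 * (n + 1)) (n + 1)) : ℝ)) -
      (2 / 3 * Real.arctan (s * √(3 - 4 * s) / (2 - 3 * s)) ^ 2 -
        1 / 2 * Real.log (1 - s) ^ 2))
      ((∫ x in (0 : ℝ)..1, (1 - x) ^ 2 / (1 - s ^ 3 / (1 - s) ^ 2 * (x * (1 - x) ^ 2))) *
        (s ^ 2 * (3 - s) / (1 - s) ^ 3) - (Real.log (1 - s) / (1 - s) +
        2 / ((1 - s) * √(3 - 4 * s)) * Real.arctan (s * √(3 - 4 * s) / (2 - 3 * s)))) s := by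
    intro s hs
    have hs1 : 0 < 1 - s := by linarith [hs.2]
    have d1 : HasDerivAt (fun s : ℝ => 1 - s) (-1) s := by
      simpa using (hasDerivAt_id s).const_sub 1
    have dt : HasDerivAt (fun s : ℝ => s ^ 3 / (1 - s) ^ 2) (s ^ 2 * (3 - s) / (1 - s) ^ 3) s := by
      convert! (hasDerivAt_pow 3 s).div (d1.pow 2) (pow_ne_zero 2 hs1.ne') using 1
      simp only [Pi.pow_apply]
      push_cast
      field_simp
      ring
    have hF := (hasDerivAt_tsum_pow_div_sq_mul_choose (ht s hs)).comp s dt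
    have hA := ((hasDerivAt_arctan_mul_sqrt_div hs.2).pow 2).const_mul (2 / 3)
    have hL := ((d1.log hs1.ne').pow 2).const_mul (1 / 2)
    convert! hF.sub (hA.sub hL) using 1
    have : 0 < √(3 - 4 * s) := Real.sqrt_pos.2 (by linarith [hs.2])
    congr 1
    push_cast
    field_simp
    ring
  rcases hs.1.eq_or_lt with rfl | hs0
  · simp
  have hsub : ∀ r ∈ Icc 0 s, r ∈ Icc (0 : ℝ) (1 / 3) := fun r hr => ⟨hr.1, hr.2.trans hs.2⟩
  obtain ⟨c, hc, hslope⟩ := exists_hasDerivAt_eq_slope _ _ hs0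
    (fun r hr => (hderiv r (hsub r hr)).continuousAt.continuousWithinAt)
    (fun r hr => hderiv r (hsub r (Ioo_subset_Icc_self hr)))
  rw [integral_one_sub_sq_div hc.1 (hc.2.trans_le hs.2), sub_self, eq_comm,
    div_eq_zero_iff, or_iff_left (by linarith)] at hslope
  simpa [sub_eq_zero] using hslope

theorem stmt_10 :
    ∑' n : ℕ,
        (1 : ℝ) / ((n + 1) ^ 2 * 12 ^ (n + 1) * (Nat.choose (3 * (n + 1)) (n + 1))) =
      (2 / 3) * Real.arctan (Real.sqrt 15 / 9) ^ 2 -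
        (1 / 2) * Real.log (3 / 2) ^ 2 := by
  have h := tsum_pow_div_sq_mul_choose_eq (s := 1 / 3) ⟨by norm_num, le_rfl⟩
  have harg : (1 / 3 : ℝ) * √(3 - 4 * (1 / 3)) / (2 - 3 * (1 / 3)) = √15 / 9 := by
    have : (3 - 4 * (1 / 3) : ℝ) = 15 / 3 ^ 2 := by norm_num
    rw [this, Real.sqrt_div (by norm_num), Real.sqrt_sq (by norm_num)]
    ring
  have hlog : Real.log (1 - 1 / 3) = -Real.log (3 / 2) := by
    rw [← Real.log_inv]
    norm_num
  rw [harg, hlog, neg_sq] at h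
  rw [← h]
  congr 1 with n
  rw [show (1 / 3 : ℝ) ^ 3 / (1 - 1 / 3) ^ 2 = 1 / 12 by norm_num, div_pow, one_pow, div_div]
  ring_nf
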